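/- arXiv:2305.07428 — 2 statements merged into one kernel-verified Lean document; each statement's English description precedes it below -/
import Mathlib

section
/- Let n ≥ 2 be a natural number and q > 0 a real number, and set c(n,q) = (n−2)(n+q−2)/q. Let u : EuclideanSpace ℝ (Fin n) → ℝ be three times continuously differentiable and f : EuclideanSpace ℝ (Fin n) → ℝ be twice continuously differentiable. Then at every point x one has (1/2)·Δ(e^{−2f}‖∇u‖²)(x) − ⟪∇(e^{−2f}·Δu)(x), ∇u(x)⟫ ≥ e^{−2f(x)}·( (Δu(x))²/(n+q) − (Δf(x) + c(n,q)·‖∇f(x)‖²)·‖∇u(x)‖² ). (This is the transformation rule of the Bakry–Émery/Bochner inequality under time change, Lemma 2.2 of the paper, in the case of the flat Euclidean metric, where Ric ≡ 0.) -/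
open RealInnerProductSpace

/-- The Euclidean Laplacian `Δu = ∑ᵢ ∂²u/∂xᵢ²` (analyst's sign convention). -/
noncomputable def laplacian {n : ℕ} (u : EuclideanSpace ℝ (Fin n) → ℝ)
    (x : EuclideanSpace ℝ (Fin n)) : ℝ :=
  ∑ i : Fin n, iteratedFDeriv ℝ 2 u x ![EuclideanSpace.single i 1, EuclideanSpace.single i 1]

/-- The `i`-th partial derivative of a function on Euclidean space. -/
noncomputable def partialDeriv {n : ℕ} (i : Fin n) (φ : EuclideanSpace ℝ (Fin n) → ℝ)
    (x : EuclideanSpace ℝ (Fin n)) : ℝ :=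
  fderiv ℝ φ x (EuclideanSpace.single i 1)

section PartialDeriv

variable {n : ℕ} {φ ψ : EuclideanSpace ℝ (Fin n) → ℝ} {x : EuclideanSpace ℝ (Fin n)}

theorem ContDiff.partialDeriv {k m : WithTop ℕ∞} (hφ : ContDiff ℝ m φ) (hk : k + 1 ≤ m)
    (i : Fin n) : ContDiff ℝ k (partialDeriv i φ) :=
  (hφ.fderiv_right hk).clm_apply contDiff_const

theorem partialDeriv_mul (hφ : DifferentiableAt ℝ φ x) (hψ : DifferentiableAt ℝ ψ x)
    (i : Fin n) :
    partialDeriv i (fun y => φ y * ψ y) x =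
      partialDeriv i φ x * ψ x + φ x * partialDeriv i ψ x := by
  simp only [partialDeriv]
  rw [fderiv_fun_mul hφ hψ]
  simp only [add_apply, smul_apply, smul_eq_mul]
  ring

theorem partialDeriv_const_mul (hφ : DifferentiableAt ℝ φ x) (c : ℝ) (i : Fin n) :
    partialDeriv i (fun y => c * φ y) x = c * partialDeriv i φ x := by
  simp only [partialDeriv]
  rw [fderiv_const_mul hφ]
  simp

theorem partialDeriv_add (hφ : DifferentiableAt ℝ φ x) (hψ : DifferentiableAt ℝ ψ x)
    (i : Fin n) :
    partialDeriv i (fun y => φ y + ψ y) x = partialDeriv i φ x + partialDeriv i ψ x := by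
  simp only [partialDeriv]
  rw [fderiv_fun_add hφ hψ]
  simp

theorem partialDeriv_sum {ι : Type*} {s : Finset ι} {χ : ι → EuclideanSpace ℝ (Fin n) → ℝ}
    (hχ : ∀ j ∈ s, DifferentiableAt ℝ (χ j) x) (i : Fin n) :
    partialDeriv i (fun y => ∑ j ∈ s, χ j y) x = ∑ j ∈ s, partialDeriv i (χ j) x := by
  simp only [partialDeriv]
  rw [fderiv_fun_sum hχ]
  simp

theorem partialDeriv_exp_const_mul (hφ : DifferentiableAt ℝ φ x) (c : ℝ) (i : Fin n) :
    partialDeriv i (fun y => Real.exp (c * φ y)) x =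
      c * (Real.exp (c * φ x) * partialDeriv i φ x) := by
  simp only [partialDeriv]
  rw [fderiv_exp (hφ.const_mul c), fderiv_const_mul hφ]
  simp only [smul_apply, smul_eq_mul]
  ring

theorem partialDeriv_partialDeriv (hφ : ContDiff ℝ 2 φ) (i j : Fin n) :
    partialDeriv i (partialDeriv j φ) x =
      fderiv ℝ (fderiv ℝ φ) x (EuclideanSpace.single i 1) (EuclideanSpace.single j 1) := by
  have hd : DifferentiableAt ℝ (fderiv ℝ φ) x :=
    (hφ.fderiv_right (m := 1) (by norm_num)).differentiable (by norm_num) x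
  change fderiv ℝ (fun y => fderiv ℝ φ y (EuclideanSpace.single j 1)) x _ = _
  rw [fderiv_clm_apply hd (differentiableAt_const _)]
  simp

theorem partialDeriv_comm (hφ : ContDiff ℝ 2 φ) (i j : Fin n) :
    partialDeriv i (partialDeriv j φ) = partialDeriv j (partialDeriv i φ) := by
  funext y
  rw [partialDeriv_partialDeriv hφ, partialDeriv_partialDeriv hφ]
  exact (hφ.contDiffAt.isSymmSndFDerivAt (by simp)) _ _

theorem laplacian_eq_sum_partialDeriv (hφ : ContDiff ℝ 2 φ) :
    laplacian φ x = ∑ i, partialDeriv i (partialDeriv i φ) x := by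
  simp only [laplacian, partialDeriv_partialDeriv hφ, iteratedFDeriv_two_apply]
  simp

theorem gradient_apply_eq_partialDeriv (i : Fin n) : gradient φ x i = partialDeriv i φ x := by
  have h : ⟪gradient φ x, EuclideanSpace.single i (1 : ℝ)⟫ = gradient φ x i := by
    rw [EuclideanSpace.inner_single_right]
    simp
  rw [← h]
  simp [gradient, partialDeriv]

theorem inner_gradient_gradient :
    ⟪gradient φ x, gradient ψ x⟫ = ∑ i, partialDeriv i φ x * partialDeriv i ψ x := by
  simp only [PiLp.inner_apply, gradient_apply_eq_partialDeriv]
  simp [mul_comm]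

theorem norm_gradient_sq : ‖gradient φ x‖ ^ 2 = ∑ i, partialDeriv i φ x * partialDeriv i φ x := by
  rw [← real_inner_self_eq_norm_sq, inner_gradient_gradient]

end PartialDeriv

theorem Finset.sq_sum_diag_le_card_mul_sum_sq {ι : Type*} [Fintype ι] (K : ι → ι → ℝ) :
    (∑ i, K i i) ^ 2 ≤ Fintype.card ι * ∑ i, ∑ j, K i j ^ 2 := by
  calc (∑ i, K i i) ^ 2 ≤ Fintype.card ι * ∑ i, K i i ^ 2 := by
        simpa using sq_sum_le_card_mul_sum_sq (s := Finset.univ) (f := fun i => K i i)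
    _ ≤ _ := by
        gcongr with i
        exact Finset.single_le_sum (f := fun j => K i j ^ 2) (fun _ _ => sq_nonneg _)
          (Finset.mem_univ i)

/-- The pointwise algebraic inequality behind the time change rule: `H` plays the role of the
Hessian of `u`, and `F`, `U` of the gradients of `f` and `u`. -/
theorem sq_trace_div_le_of_symm {n : ℕ} (hn : 2 ≤ n) {q : ℝ} (hq : 0 < q)
    (H : Fin n → Fin n → ℝ) (hH : ∀ i j, H i j = H j i) (F U : Fin n → ℝ) :
    (∑ i, H i i) ^ 2 / ((n : ℝ) + q) ≤
      ∑ i, ∑ j, H i j ^ 2 - 4 * ∑ i, ∑ j, F i * (U j * H i j)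
        + 2 * (∑ i, H i i) * (∑ i, F i * U i)
        + (2 + ((n : ℝ) - 2) * ((n : ℝ) + q - 2) / q)
          * ((∑ i, F i * F i) * ∑ i, U i * U i) := by
  have hK := Finset.sq_sum_diag_le_card_mul_sum_sq (fun i j => H i j - (F i * U j + F j * U i))
  have hdiag : ∑ i, (H i i - (F i * U i + F i * U i)) = ∑ i, H i i - 2 * ∑ i, F i * U i := by
    rw [Finset.sum_sub_distrib, Finset.mul_sum]
    congr 1
    exact Finset.sum_congr rfl fun i _ => by ring
  have hswap : ∑ i, ∑ j, F j * (U i * H i j) = ∑ i, ∑ j, F i * (U j * H i j) := by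
    rw [Finset.sum_comm]
    exact Finset.sum_congr rfl fun i _ => Finset.sum_congr rfl fun j _ => by rw [hH]
  have hFU : ∑ i, ∑ j, (F i * F i) * (U j * U j) = (∑ i, F i * F i) * ∑ i, U i * U i := by
    rw [Finset.sum_mul_sum]
  have hUF : ∑ i, ∑ j, (U i * U i) * (F j * F j) = (∑ i, F i * F i) * ∑ i, U i * U i := by
    rw [← Finset.sum_mul_sum, mul_comm]
  have hcross : ∑ i, ∑ j, (F i * U i) * (F j * U j) = (∑ i, F i * U i) ^ 2 := by
    rw [← Finset.sum_mul_sum, sq]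
  have hexp : ∑ i, ∑ j, (H i j - (F i * U j + F j * U i)) ^ 2 =
      ∑ i, ∑ j, H i j ^ 2 - 4 * ∑ i, ∑ j, F i * (U j * H i j)
        + 2 * ((∑ i, F i * F i) * ∑ i, U i * U i) + 2 * (∑ i, F i * U i) ^ 2 := by
    have : ∑ i, ∑ j, (H i j - (F i * U j + F j * U i)) ^ 2 =
        ∑ i, ∑ j, H i j ^ 2 - 2 * ∑ i, ∑ j, F i * (U j * H i j)
          - 2 * ∑ i, ∑ j, F j * (U i * H i j) + ∑ i, ∑ j, (F i * F i) * (U j * U j)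
          + ∑ i, ∑ j, (U i * U i) * (F j * F j)
          + 2 * ∑ i, ∑ j, (F i * U i) * (F j * U j) := by
      simp only [Finset.mul_sum, ← Finset.sum_sub_distrib, ← Finset.sum_add_distrib]
      exact Finset.sum_congr rfl fun i _ => Finset.sum_congr rfl fun j _ => by ring
    rw [this, hswap, hFU, hUF, hcross]
    ring
  have hCS : (∑ i, F i * U i) ^ 2 ≤ (∑ i, F i * F i) * ∑ i, U i * U i := by
    simpa only [sq] using Finset.sum_mul_sq_le_sq_mul_sq Finset.univ F U
  rw [hdiag, hexp, Fintype.card_fin] at hK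
  have hn' : (2 : ℝ) ≤ n := by exact_mod_cast hn
  generalize ∑ i, H i i = T at *
  generalize ∑ i, F i * U i = a at *
  generalize (∑ i, F i * F i) * ∑ i, U i * U i = P at *
  generalize ∑ i, ∑ j, H i j ^ 2 - 4 * ∑ i, ∑ j, F i * (U j * H i j) = Q at *
  generalize (n : ℝ) = N at *
  have hN : 0 < N := by linarith
  have hc : 0 ≤ (N - 2) * (N + q - 2) / q :=
    div_nonneg (mul_nonneg (by linarith) (by linarith)) hq.le
  have hQ : (T - 2 * a) ^ 2 / N ≤ Q + 2 * P + 2 * a ^ 2 := (div_le_iff₀' hN).2 hK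
  have hP := mul_le_mul_of_nonneg_left hCS hc
  have hsq : 0 ≤ q / (N * (N + q)) * (T + (N - 2) * (N + q) / q * a) ^ 2 := by positivity
  have hid : (T - 2 * a) ^ 2 / N - 2 * a ^ 2 + 2 * T * a + (N - 2) * (N + q - 2) / q * a ^ 2
      - T ^ 2 / (N + q) = q / (N * (N + q)) * (T + (N - 2) * (N + q) / q * a) ^ 2 := by
    have : N + q ≠ 0 := by positivity
    field_simp
    ring
  linarith

/-- Transformation rule of the Bochner/Bakry–Émery inequality under time change
(Lemma 2.2 of the paper) in the flat Euclidean case, where `Ric ≡ 0`. -/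
theorem bakry_emery_time_change {n : ℕ} (hn : 2 ≤ n) (q : ℝ) (hq : 0 < q)
    (u : EuclideanSpace ℝ (Fin n) → ℝ) (f : EuclideanSpace ℝ (Fin n) → ℝ)
    (hu : ContDiff ℝ 3 u) (hf : ContDiff ℝ 2 f) (x : EuclideanSpace ℝ (Fin n)) :
    (1 / 2) * laplacian (fun y => Real.exp (-2 * f y) * ‖gradient u y‖ ^ 2) x
        - ⟪gradient (fun y => Real.exp (-2 * f y) * laplacian u y) x, gradient u x⟫
      ≥ Real.exp (-2 * f x) *
          ((laplacian u x) ^ 2 / ((n : ℝ) + q)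
            - (laplacian f x + ((n : ℝ) - 2) * ((n : ℝ) + q - 2) / q * ‖gradient f x‖ ^ 2)
                * ‖gradient u x‖ ^ 2) := by
  have hu1 (i : Fin n) : ContDiff ℝ 2 (partialDeriv i u) := hu.partialDeriv (by norm_num) i
  have hu2 (i j : Fin n) : ContDiff ℝ 1 (partialDeriv i (partialDeriv j u)) :=
    (hu1 j).partialDeriv (by norm_num) i
  have hf1 (i : Fin n) : ContDiff ℝ 1 (partialDeriv i f) := hf.partialDeriv (by norm_num) i
  have hw : ContDiff ℝ 2 (fun y => Real.exp (-2 * f y)) := (contDiff_const.mul hf).exp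
  have hg : ContDiff ℝ 2 (fun y => ∑ j, partialDeriv j u y * partialDeriv j u y) :=
    ContDiff.sum fun j _ => (hu1 j).mul (hu1 j)
  have hdf : Differentiable ℝ f := hf.differentiable (by norm_num)
  have hdf1 (i : Fin n) : Differentiable ℝ (partialDeriv i f) :=
    (hf1 i).differentiable (by norm_num)
  have hdu1 (i : Fin n) : Differentiable ℝ (partialDeriv i u) :=
    (hu1 i).differentiable (by norm_num)
  have hdu2 (i j : Fin n) : Differentiable ℝ (partialDeriv i (partialDeriv j u)) :=
    (hu2 i j).differentiable (by norm_num)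
  have hdw : Differentiable ℝ (fun y => Real.exp (-2 * f y)) := hw.differentiable (by norm_num)
  have hdg : Differentiable ℝ (fun y => ∑ j, partialDeriv j u y * partialDeriv j u y) :=
    hg.differentiable (by norm_num)
  have hdh (i : Fin n) : Differentiable ℝ
      (fun y => ∑ j, partialDeriv j u y * partialDeriv i (partialDeriv j u) y) :=
    Differentiable.fun_sum fun j _ => (hdu1 j).mul (hdu2 i j)
  have hu' : ContDiff ℝ 2 u := hu.of_le (by norm_num)
  have hsymm (i j : Fin n) := partialDeriv_comm hu' i j
  have hpg (i : Fin n) (y) : partialDeriv i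
      (fun y => ∑ j, partialDeriv j u y * partialDeriv j u y) y =
      2 * ∑ j, partialDeriv j u y * partialDeriv i (partialDeriv j u) y := by
    rw [partialDeriv_sum (fun j _ => (hdu1 j y).fun_mul (hdu1 j y)), Finset.mul_sum]
    refine Finset.sum_congr rfl fun j _ => ?_
    rw [partialDeriv_mul (hdu1 j y) (hdu1 j y)]
    ring
  have hph (i : Fin n) : partialDeriv i
      (fun y => ∑ j, partialDeriv j u y * partialDeriv i (partialDeriv j u) y) x =
      ∑ j, (partialDeriv i (partialDeriv j u) x ^ 2
        + partialDeriv j u x * partialDeriv j (partialDeriv i (partialDeriv i u)) x) := by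
    rw [partialDeriv_sum (fun j _ => (hdu1 j x).fun_mul (hdu2 i j x))]
    refine Finset.sum_congr rfl fun j _ => ?_
    rw [partialDeriv_mul (hdu1 j x) (hdu2 i j x), partialDeriv_comm (hu1 i) j i, hsymm j i]
    ring
  have hpwg (i : Fin n) : partialDeriv i (fun y => Real.exp (-2 * f y) *
      ∑ j, partialDeriv j u y * partialDeriv j u y) = fun y => Real.exp (-2 * f y) *
      (2 * (∑ j, partialDeriv j u y * partialDeriv i (partialDeriv j u) y
        + -1 * (partialDeriv i f y * ∑ j, partialDeriv j u y * partialDeriv j u y))) := by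
    funext y
    rw [partialDeriv_mul (hdw y) (hdg y), hpg, partialDeriv_exp_const_mul (hdf y)]
    ring
  have hleft (i : Fin n) : partialDeriv i (partialDeriv i (fun y => Real.exp (-2 * f y) *
      ∑ j, partialDeriv j u y * partialDeriv j u y)) x = Real.exp (-2 * f x) * (2 *
      (∑ j, (partialDeriv i (partialDeriv j u) x ^ 2
          + partialDeriv j u x * partialDeriv j (partialDeriv i (partialDeriv i u)) x)
        - 4 * (partialDeriv i f x * ∑ j, partialDeriv j u x * partialDeriv i (partialDeriv j u) x)
        + (2 * (partialDeriv i f x * partialDeriv i f x) - partialDeriv i (partialDeriv i f) x)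
          * ∑ j, partialDeriv j u x * partialDeriv j u x)) := by
    have hd1 := (hdf1 i x).fun_mul (hdg x)
    have hd2 := (hdh i x).fun_add (hd1.const_mul (-1))
    rw [hpwg, partialDeriv_mul (hdw x) (hd2.const_mul 2), partialDeriv_const_mul hd2,
      partialDeriv_add (hdh i x) (hd1.const_mul (-1)), partialDeriv_const_mul hd1,
      partialDeriv_mul (hdf1 i x) (hdg x), hpg, hph, partialDeriv_exp_const_mul (hdf x)]
    ring
  have hdL : Differentiable ℝ (fun y => ∑ i, partialDeriv i (partialDeriv i u) y) :=
    Differentiable.fun_sum fun i _ => hdu2 i i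
  have hright (j : Fin n) : partialDeriv j (fun y => Real.exp (-2 * f y) *
      ∑ i, partialDeriv i (partialDeriv i u) y) x * partialDeriv j u x = Real.exp (-2 * f x) *
      (∑ i, partialDeriv j u x * partialDeriv j (partialDeriv i (partialDeriv i u)) x
        - 2 * (∑ i, partialDeriv i (partialDeriv i u) x)
          * (partialDeriv j f x * partialDeriv j u x)) := by
    rw [partialDeriv_mul (hdw x) (hdL x), partialDeriv_sum (fun i _ => hdu2 i i x),
      partialDeriv_exp_const_mul (hdf x), ← Finset.mul_sum]
    ring
  have key := sq_trace_div_le_of_symm hn hq (fun i j => partialDeriv i (partialDeriv j u) x)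
    (fun i j => congrFun (hsymm i j) x) (fun i => partialDeriv i f x) (fun i => partialDeriv i u x)
  have hthird : ∑ j, ∑ i, partialDeriv j u x * partialDeriv j (partialDeriv i (partialDeriv i u)) x
      = ∑ i, ∑ j, partialDeriv j u x * partialDeriv j (partialDeriv i (partialDeriv i u)) x :=
    Finset.sum_comm
  simp only [norm_gradient_sq, inner_gradient_gradient, laplacian_eq_sum_partialDeriv hu',
    laplacian_eq_sum_partialDeriv hf]
  rw [laplacian_eq_sum_partialDeriv (hw.mul hg)]
  simp only [hleft, hright, ← Finset.mul_sum]
  rw [← mul_assoc, mul_comm (1 / 2 : ℝ), mul_assoc, ← mul_sub, ge_iff_le]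
  refine mul_le_mul_of_nonneg_left ?_ (Real.exp_pos _).le
  simp only [Finset.sum_sub_distrib, Finset.sum_add_distrib, ← Finset.sum_mul, ← Finset.mul_sum]
    at key hthird ⊢
  linarith
end

section
/- For every real number σ ≥ 0, one has σ ≤ sinh(σ) ≤ σ·e^{σ²/4}. -/
theorem Nat.four_pow_mul_factorial_le (n : ℕ) :
    4 ^ n * n.factorial ≤ (2 * n + 1).factorial := by
  induction n with
  | zero => simp
  | succ n ih =>
    have h : (2 * (n + 1) + 1).factorial = (2 * n + 3) * (2 * n + 2) * (2 * n + 1).factorial := by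
      rw [show 2 * (n + 1) + 1 = 2 * n + 1 + 1 + 1 by ring, Nat.factorial_succ,
        Nat.factorial_succ]
      ring
    calc 4 ^ (n + 1) * (n + 1).factorial = 4 * (n + 1) * (4 ^ n * n.factorial) := by
          rw [Nat.factorial_succ]; ring
      _ ≤ (2 * n + 3) * (2 * n + 2) * (2 * n + 1).factorial :=
          Nat.mul_le_mul (by nlinarith) ih
      _ = _ := h.symm

theorem Real.sinh_le_mul_exp_sq_div_four {x : ℝ} (hx : 0 ≤ x) :
    Real.sinh x ≤ x * Real.exp (x ^ 2 / 4) := by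
  have hexp : HasSum (fun n : ℕ ↦ (x ^ 2 / 4) ^ n / n.factorial) (Real.exp (x ^ 2 / 4)) := by
    rw [Real.exp_eq_exp_ℝ]
    exact NormedSpace.expSeries_div_hasSum_exp _
  refine hasSum_le (fun n ↦ ?_) (Real.hasSum_sinh x) (hexp.mul_left x)
  calc x ^ (2 * n + 1) / ((2 * n + 1).factorial : ℝ)
      ≤ x ^ (2 * n + 1) / (4 ^ n * n.factorial) := by
        gcongr
        exact_mod_cast Nat.four_pow_mul_factorial_le n
    _ = x * ((x ^ 2 / 4) ^ n / n.factorial) := by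
        rw [div_pow, div_div, ← pow_mul, ← mul_div_assoc, pow_succ']

/-- For every `σ ≥ 0`, `σ ≤ sinh σ ≤ σ·exp(σ²/4)`. -/
theorem self_le_sinh_le (σ : ℝ) (hσ : 0 ≤ σ) :
    σ ≤ Real.sinh σ ∧ Real.sinh σ ≤ σ * Real.exp (σ ^ 2 / 4) :=
  ⟨Real.self_le_sinh_iff.2 hσ, Real.sinh_le_mul_exp_sq_div_four hσ⟩
end
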